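/- Let A,B be real 2×2 matrices with det B ≠ 0 and det(B−A)=0. Then |B| ≤ √2 · K(B) · |A|, where |·| denotes the Hilbert–Schmidt norm and K(B) = ‖B‖²/|det B| is the distortion of B (‖·‖ the operator norm). -/

import Mathlib

/-!
Statement 1.  For real 2×2 matrices `A, B` with `det B ≠ 0` and `det (B − A) = 0`:
`|B| ≤ √2 · K(B) · |A|`, where `|·|` is the Hilbert–Schmidt (Frobenius) norm,
`‖·‖` the operator norm (as a map of Euclidean ℝ²), and `K(B) = ‖B‖²/|det B|`.
-/

noncomputable section

/-- Hilbert–Schmidt (Frobenius) norm of a real 2×2 matrix. -/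
def hsNormM (A : Matrix (Fin 2) (Fin 2) ℝ) : ℝ :=
  Real.sqrt (A 0 0 ^ 2 + A 0 1 ^ 2 + A 1 0 ^ 2 + A 1 1 ^ 2)

/-- Operator norm of a real 2×2 matrix acting on Euclidean ℝ². -/
def opNormM (A : Matrix (Fin 2) (Fin 2) ℝ) : ℝ :=
  sSup {r | ∃ v : Fin 2 → ℝ, v 0 ^ 2 + v 1 ^ 2 = 1 ∧
    r = Real.sqrt (A.mulVec v 0 ^ 2 + A.mulVec v 1 ^ 2)}

/-- Distortion `K(A) = ‖A‖² / |det A|`. -/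
def distortionM (A : Matrix (Fin 2) (Fin 2) ℝ) : ℝ := opNormM A ^ 2 / |A.det|

lemma sq_mulVec_le_hsNormM (A : Matrix (Fin 2) (Fin 2) ℝ) (v : Fin 2 → ℝ) :
    A.mulVec v 0 ^ 2 + A.mulVec v 1 ^ 2 ≤ hsNormM A ^ 2 * (v 0 ^ 2 + v 1 ^ 2) := by
  rw [hsNormM, Real.sq_sqrt (by positivity)]
  simp only [Matrix.mulVec, dotProduct, Fin.sum_univ_two]
  linarith [sq_nonneg (A 0 0 * v 1 - A 0 1 * v 0), sq_nonneg (A 1 0 * v 1 - A 1 1 * v 0)]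

lemma hsNormM_nonneg (A : Matrix (Fin 2) (Fin 2) ℝ) : 0 ≤ hsNormM A :=
  Real.sqrt_nonneg _

lemma sqrt_mulVec_le_opNormM (A : Matrix (Fin 2) (Fin 2) ℝ) {v : Fin 2 → ℝ}
    (hv : v 0 ^ 2 + v 1 ^ 2 = 1) :
    Real.sqrt (A.mulVec v 0 ^ 2 + A.mulVec v 1 ^ 2) ≤ opNormM A := by
  refine le_csSup ⟨hsNormM A, ?_⟩ ⟨v, hv, rfl⟩
  rintro r ⟨w, hw, rfl⟩
  refine Real.sqrt_le_iff.2 ⟨hsNormM_nonneg A, ?_⟩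
  simpa [hw] using sq_mulVec_le_hsNormM A w

lemma opNormM_nonneg (A : Matrix (Fin 2) (Fin 2) ℝ) : 0 ≤ opNormM A :=
  (Real.sqrt_nonneg _).trans (sqrt_mulVec_le_opNormM A (v := ![1, 0]) (by simp))

lemma sq_mulVec_le_opNormM (A : Matrix (Fin 2) (Fin 2) ℝ) (v : Fin 2 → ℝ) :
    A.mulVec v 0 ^ 2 + A.mulVec v 1 ^ 2 ≤ opNormM A ^ 2 * (v 0 ^ 2 + v 1 ^ 2) := by
  rcases (add_nonneg (sq_nonneg (v 0)) (sq_nonneg (v 1))).eq_or_lt with h | h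
  · have := sq_mulVec_le_hsNormM A v
    rw [← h] at this ⊢
    simpa using this
  · set n := Real.sqrt (v 0 ^ 2 + v 1 ^ 2) with hn
    have hn0 : 0 < n := Real.sqrt_pos.2 h
    have hn2 : n ^ 2 = v 0 ^ 2 + v 1 ^ 2 := Real.sq_sqrt h.le
    have hu : (n⁻¹ • v) 0 ^ 2 + (n⁻¹ • v) 1 ^ 2 = 1 := by
      simp only [Pi.smul_apply, smul_eq_mul]
      field_simp
      exact hn2.symm
    have key := (Real.sqrt_le_iff.1 (sqrt_mulVec_le_opNormM A hu)).2
    rw [Matrix.mulVec_smul] at key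
    simp only [Pi.smul_apply, smul_eq_mul, mul_pow, ← mul_add, inv_pow] at key
    rw [hn2, inv_mul_le_iff₀ h] at key
    linarith

lemma hsNormM_le_sqrt_two_mul_opNormM (A : Matrix (Fin 2) (Fin 2) ℝ) :
    hsNormM A ≤ Real.sqrt 2 * opNormM A := by
  refine Real.sqrt_le_iff.2 ⟨mul_nonneg (Real.sqrt_nonneg _) (opNormM_nonneg A), ?_⟩
  rw [mul_pow, Real.sq_sqrt zero_le_two]
  have h1 := sq_mulVec_le_opNormM A ![1, 0]
  have h2 := sq_mulVec_le_opNormM A ![0, 1]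
  simp [Matrix.mulVec, dotProduct, Fin.sum_univ_two] at h1 h2
  linarith

lemma abs_det_le_opNormM_mul_hsNormM (A B : Matrix (Fin 2) (Fin 2) ℝ)
    (hAB : (B - A).det = 0) : |B.det| ≤ opNormM B * hsNormM A := by
  obtain ⟨v, hv, hBA⟩ := Matrix.exists_mulVec_eq_zero_iff.2 hAB
  rw [Matrix.sub_mulVec, sub_eq_zero] at hBA
  have hpos : 0 < v 0 ^ 2 + v 1 ^ 2 := by
    by_contra! h
    apply hv
    ext i
    fin_cases i
    · change v 0 = 0
      nlinarith [sq_nonneg (v 0), sq_nonneg (v 1)]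
    · change v 1 = 0
      nlinarith [sq_nonneg (v 0), sq_nonneg (v 1)]
  have h1 := sq_mulVec_le_hsNormM A v
  rw [← hBA] at h1
  have h2 := sq_mulVec_le_opNormM B ![-v 1, v 0]
  have h3 : (B.det * (v 0 ^ 2 + v 1 ^ 2)) ^ 2 ≤
      (B.mulVec v 0 ^ 2 + B.mulVec v 1 ^ 2) *
        (B.mulVec ![-v 1, v 0] 0 ^ 2 + B.mulVec ![-v 1, v 0] 1 ^ 2) := by
    have hd : B.det * (v 0 ^ 2 + v 1 ^ 2) =
        B.mulVec v 0 * B.mulVec ![-v 1, v 0] 1 - B.mulVec v 1 * B.mulVec ![-v 1, v 0] 0 := by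
      simp [Matrix.mulVec, dotProduct, Fin.sum_univ_two, Matrix.det_fin_two]
      ring
    rw [hd]
    linarith [sq_nonneg (B.mulVec v 0 * B.mulVec ![-v 1, v 0] 0 +
      B.mulVec v 1 * B.mulVec ![-v 1, v 0] 1)]
  have h4 := h3.trans (mul_le_mul h1 h2 (by positivity) (by positivity))
  simp only [Matrix.cons_val_zero, Matrix.cons_val_one] at h4
  refine abs_le_of_sq_le_sq ?_ (mul_nonneg (opNormM_nonneg B) (hsNormM_nonneg A))
  refine le_of_mul_le_mul_right ?_ (pow_pos hpos 2)
  linarith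

theorem statement1 (A B : Matrix (Fin 2) (Fin 2) ℝ)
    (hB : B.det ≠ 0) (hAB : (B - A).det = 0) :
    hsNormM B ≤ Real.sqrt 2 * distortionM B * hsNormM A := by
  have h := abs_det_le_opNormM_mul_hsNormM A B hAB
  refine (hsNormM_le_sqrt_two_mul_opNormM B).trans ?_
  rw [mul_assoc]
  refine mul_le_mul_of_nonneg_left ?_ (Real.sqrt_nonneg _)
  rw [distortionM, div_mul_eq_mul_div, le_div_iff₀ (abs_pos.2 hB), sq, mul_assoc]
  exact mul_le_mul_of_nonneg_left h (opNormM_nonneg B)
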